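/- arXiv:2602.16277 — 3 statements merged into one kernel-verified Lean document; each statement's English description precedes it below -/
import Mathlib

section
/- Let μ₁, μ₂ be real numbers with 0 < μ₁ < μ₂ and let a > 0. Then the function g(D) = (μ₁ − μ₂)·√(a² − D²) + D·((μ₂ − μ₁)·arccos(D/a) + π·μ₁) is strictly increasing on [−a, a], satisfies g(−a) = −π·μ₂·a < 0, g(0) = (μ₁ − μ₂)·a < 0 and g(a) = π·μ₁·a > 0, and hence has a unique zero D* in [−a, a]; moreover 0 < D* < a, i.e. the steady-state average capsule velocity is strictly positive. -/
open Real

/-- The transcendental function whose zero determines the steady-state average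
capsule velocity in the oscillatory (2:1) resonance regime. -/
noncomputable def gOsc (μ₁ μ₂ a D : ℝ) : ℝ :=
  (μ₁ - μ₂) * Real.sqrt (a^2 - D^2) +
    D * ((μ₂ - μ₁) * Real.arccos (D / a) + Real.pi * μ₁)

theorem continuous_gOsc (μ₁ μ₂ a : ℝ) : Continuous (gOsc μ₁ μ₂ a) := by
  have := Real.continuous_arccos
  unfold gOsc
  fun_prop

theorem hasDerivAt_gOsc (μ₁ μ₂ : ℝ) {a x : ℝ} (ha : 0 < a) (hx : x ∈ Set.Ioo (-a) a) :
    HasDerivAt (gOsc μ₁ μ₂ a) ((μ₂ - μ₁) * Real.arccos (x / a) + Real.pi * μ₁) x := by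
  obtain ⟨hx₁, hx₂⟩ := hx
  have hpos : 0 < a ^ 2 - x ^ 2 := by nlinarith
  have hs : 0 < Real.sqrt (a ^ 2 - x ^ 2) := Real.sqrt_pos.2 hpos
  have hlo : x / a ≠ -1 := by
    rw [Ne, div_eq_iff ha.ne']
    linarith
  have hhi : x / a ≠ 1 := by
    rw [Ne, div_eq_iff ha.ne']
    linarith
  have hsqrt : Real.sqrt (1 - (x / a) ^ 2) = Real.sqrt (a ^ 2 - x ^ 2) / a := by
    rw [show 1 - (x / a) ^ 2 = (a ^ 2 - x ^ 2) / a ^ 2 by field_simp,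
      Real.sqrt_div' _ (sq_nonneg a), Real.sqrt_sq ha.le]
  have h₁ := (((hasDerivAt_id' x).pow 2).const_sub (a ^ 2)).sqrt hpos.ne'
  have h₂ := (Real.hasDerivAt_arccos hlo hhi).comp x ((hasDerivAt_id' x).div_const a)
  rw [hsqrt] at h₂
  refine ((h₁.const_mul (μ₁ - μ₂)).add ((hasDerivAt_id' x).mul
    ((h₂.const_mul (μ₂ - μ₁)).add_const (Real.pi * μ₁)))).congr_deriv ?_
  simp only [Function.comp_apply, Pi.pow_apply]
  field_simp
  ring

theorem strictMonoOn_gOsc {μ₁ μ₂ a : ℝ} (h₁ : 0 < μ₁) (h₁₂ : μ₁ ≤ μ₂) (ha : 0 < a) :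
    StrictMonoOn (gOsc μ₁ μ₂ a) (Set.Icc (-a) a) := by
  refine strictMonoOn_of_deriv_pos (convex_Icc _ _) (continuous_gOsc μ₁ μ₂ a).continuousOn ?_
  intro x hx
  rw [interior_Icc] at hx
  rw [(hasDerivAt_gOsc μ₁ μ₂ ha hx).deriv]
  have := mul_nonneg (sub_nonneg.2 h₁₂) (Real.arccos_nonneg (x / a))
  have := mul_pos Real.pi_pos h₁
  linarith

theorem gOsc_neg_self (μ₁ μ₂ : ℝ) {a : ℝ} (ha : a ≠ 0) :
    gOsc μ₁ μ₂ a (-a) = -(Real.pi * μ₂ * a) := by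
  simp only [gOsc, neg_div, div_self ha, Real.arccos_neg_one, neg_sq, sub_self, Real.sqrt_zero]
  ring

theorem gOsc_zero (μ₁ μ₂ : ℝ) {a : ℝ} (ha : 0 ≤ a) : gOsc μ₁ μ₂ a 0 = (μ₁ - μ₂) * a := by
  simp [gOsc, Real.sqrt_sq ha]

theorem gOsc_self (μ₁ μ₂ : ℝ) {a : ℝ} (ha : a ≠ 0) :
    gOsc μ₁ μ₂ a a = Real.pi * μ₁ * a := by
  simp only [gOsc, div_self ha, Real.arccos_one, sub_self, Real.sqrt_zero]
  ring

theorem gOsc_unique_positive_zero (μ₁ μ₂ a : ℝ)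
    (h₁ : 0 < μ₁) (h₁₂ : μ₁ < μ₂) (ha : 0 < a) :
    StrictMonoOn (gOsc μ₁ μ₂ a) (Set.Icc (-a) a) ∧
    gOsc μ₁ μ₂ a (-a) = -(Real.pi * μ₂ * a) ∧ -(Real.pi * μ₂ * a) < 0 ∧
    gOsc μ₁ μ₂ a 0 = (μ₁ - μ₂) * a ∧ (μ₁ - μ₂) * a < 0 ∧
    gOsc μ₁ μ₂ a a = Real.pi * μ₁ * a ∧ 0 < Real.pi * μ₁ * a ∧
    (∃! D : ℝ, D ∈ Set.Icc (-a) a ∧ gOsc μ₁ μ₂ a D = 0) ∧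
    (∀ D : ℝ, D ∈ Set.Icc (-a) a → gOsc μ₁ μ₂ a D = 0 → 0 < D ∧ D < a) := by
  have hmono := strictMonoOn_gOsc h₁ h₁₂.le ha
  have hneg := gOsc_neg_self μ₁ μ₂ ha.ne'
  have hzero := gOsc_zero μ₁ μ₂ ha.le
  have hself := gOsc_self μ₁ μ₂ ha.ne'
  have hneg_lt : -(Real.pi * μ₂ * a) < 0 :=
    neg_lt_zero.2 (mul_pos (mul_pos Real.pi_pos (h₁.trans h₁₂)) ha)
  have hzero_lt : (μ₁ - μ₂) * a < 0 := mul_neg_of_neg_of_pos (sub_neg.2 h₁₂) ha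
  have hself_pos : 0 < Real.pi * μ₁ * a := mul_pos (mul_pos Real.pi_pos h₁) ha
  have hle : -a ≤ a := by linarith
  refine ⟨hmono, hneg, hneg_lt, hzero, hzero_lt, hself, hself_pos, ?_, fun D hD hD0 => ⟨?_, ?_⟩⟩
  · obtain ⟨D, hD, hD0⟩ := intermediate_value_Icc hle (continuous_gOsc μ₁ μ₂ a).continuousOn
      (show (0 : ℝ) ∈ Set.Icc _ _ by
        rw [hneg, hself]
        exact ⟨hneg_lt.le, hself_pos.le⟩)
    exact ⟨D, ⟨hD, hD0⟩, fun E hE => hmono.injOn hE.1 hD (hE.2.trans hD0.symm)⟩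
  · rw [← hmono.lt_iff_lt ⟨by linarith, ha.le⟩ hD, hzero, hD0]
    exact hzero_lt
  · rw [← hmono.lt_iff_lt hD ⟨hle, le_rfl⟩, hself, hD0]
    exact hself_pos
end

section
/- Let μ₁, μ₂ be real numbers with 0 < μ₁ < μ₂ and let c > 0. Then the function h(D) = (μ₁ − μ₂)·(D·arcsin(D/c) + √(c² − D²)) + (π/2)·(μ₁ + μ₂)·D is strictly increasing on [−c, c], satisfies h(−c) = −π·μ₂·c < 0, h(0) = (μ₁ − μ₂)·c < 0 and h(c) = π·μ₁·c > 0, and hence has a unique zero D* in [−c, c]; moreover 0 < D* < c, i.e. the steady-state average capsule velocity in the rotatory regime is strictly positive. -/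
open Real

/-- The transcendental function whose zero determines the steady-state average
capsule velocity in the rotatory (1:1) resonance regime. -/
noncomputable def hRot (μ₁ μ₂ c D : ℝ) : ℝ :=
  (μ₁ - μ₂) * (D * Real.arcsin (D / c) + Real.sqrt (c^2 - D^2)) +
    (Real.pi / 2) * (μ₁ + μ₂) * D

theorem hasDerivAt_mul_arcsin_div_add_sqrt {c D : ℝ} (hc : 0 < c) (hD : D ∈ Set.Ioo (-c) c) :
    HasDerivAt (fun x => x * Real.arcsin (x / c) + Real.sqrt (c ^ 2 - x ^ 2))
      (Real.arcsin (D / c)) D := by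
  obtain ⟨hl, hr⟩ := hD
  have hpos : 0 < c ^ 2 - D ^ 2 := by nlinarith
  have hsqrt : Real.sqrt (1 - (D / c) ^ 2) = Real.sqrt (c ^ 2 - D ^ 2) / c := by
    rw [show 1 - (D / c) ^ 2 = (c ^ 2 - D ^ 2) / c ^ 2 by field_simp,
      Real.sqrt_div hpos.le, Real.sqrt_sq hc.le]
  have hne : Real.sqrt (c ^ 2 - D ^ 2) ≠ 0 := (Real.sqrt_pos.2 hpos).ne'
  have hl' : D / c ≠ -1 := by
    rw [Ne, div_eq_iff hc.ne']
    linarith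
  have hr' : D / c ≠ 1 := by
    rw [Ne, div_eq_iff hc.ne']
    linarith
  have harcsin : HasDerivAt (fun x => Real.arcsin (x / c))
      (1 / Real.sqrt (1 - (D / c) ^ 2) * (1 / c)) D :=
    HasDerivAt.comp D (Real.hasDerivAt_arcsin hl' hr') ((hasDerivAt_id D).div_const c)
  have hroot := (((hasDerivAt_id' D).pow 2).const_sub (c ^ 2)).sqrt hpos.ne'
  refine (((hasDerivAt_id' D).mul harcsin).add hroot).congr_deriv ?_
  simp only [hsqrt, Pi.pow_apply]
  field_simp
  norm_num
  ring

theorem continuous_hRot (μ₁ μ₂ c : ℝ) : Continuous (hRot μ₁ μ₂ c) := by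
  unfold hRot
  fun_prop

theorem hasDerivAt_hRot (μ₁ μ₂ : ℝ) {c D : ℝ} (hc : 0 < c) (hD : D ∈ Set.Ioo (-c) c) :
    HasDerivAt (hRot μ₁ μ₂ c)
      ((μ₁ - μ₂) * Real.arcsin (D / c) + Real.pi / 2 * (μ₁ + μ₂)) D := by
  exact (((hasDerivAt_mul_arcsin_div_add_sqrt hc hD).const_mul (μ₁ - μ₂)).add
    ((hasDerivAt_id' D).const_mul (Real.pi / 2 * (μ₁ + μ₂)))).congr_deriv (by ring)

theorem strictMonoOn_hRot {μ₁ μ₂ c : ℝ} (h₁ : 0 < μ₁) (h₁₂ : μ₁ < μ₂) (hc : 0 < c) :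
    StrictMonoOn (hRot μ₁ μ₂ c) (Set.Icc (-c) c) := by
  refine strictMonoOn_of_deriv_pos (convex_Icc _ _) (continuous_hRot μ₁ μ₂ c).continuousOn ?_
  intro D hD
  rw [interior_Icc] at hD
  rw [(hasDerivAt_hRot μ₁ μ₂ hc hD).deriv]
  nlinarith [mul_le_mul_of_nonneg_left (Real.arcsin_le_pi_div_two (D / c)) (sub_pos.2 h₁₂).le,
    mul_pos Real.pi_pos h₁]

theorem hRot_neg_self (μ₁ μ₂ : ℝ) {c : ℝ} (hc : 0 < c) :
    hRot μ₁ μ₂ c (-c) = -(Real.pi * μ₂ * c) := by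
  simp only [hRot, neg_div, div_self hc.ne', Real.arcsin_neg, Real.arcsin_one, neg_sq, sub_self,
    Real.sqrt_zero]
  ring

theorem hRot_zero (μ₁ μ₂ : ℝ) {c : ℝ} (hc : 0 < c) : hRot μ₁ μ₂ c 0 = (μ₁ - μ₂) * c := by
  simp [hRot, Real.sqrt_sq hc.le]

theorem hRot_self (μ₁ μ₂ : ℝ) {c : ℝ} (hc : 0 < c) : hRot μ₁ μ₂ c c = Real.pi * μ₁ * c := by
  simp only [hRot, div_self hc.ne', Real.arcsin_one, sub_self, Real.sqrt_zero]
  ring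

theorem hRot_unique_positive_zero (μ₁ μ₂ c : ℝ)
    (h₁ : 0 < μ₁) (h₁₂ : μ₁ < μ₂) (hc : 0 < c) :
    StrictMonoOn (hRot μ₁ μ₂ c) (Set.Icc (-c) c) ∧
    hRot μ₁ μ₂ c (-c) = -(Real.pi * μ₂ * c) ∧ -(Real.pi * μ₂ * c) < 0 ∧
    hRot μ₁ μ₂ c 0 = (μ₁ - μ₂) * c ∧ (μ₁ - μ₂) * c < 0 ∧
    hRot μ₁ μ₂ c c = Real.pi * μ₁ * c ∧ 0 < Real.pi * μ₁ * c ∧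
    (∃! D : ℝ, D ∈ Set.Icc (-c) c ∧ hRot μ₁ μ₂ c D = 0) ∧
    (∀ D : ℝ, D ∈ Set.Icc (-c) c → hRot μ₁ μ₂ c D = 0 → 0 < D ∧ D < c) := by
  have hmono := strictMonoOn_hRot h₁ h₁₂ hc
  have hμ₂ : 0 < μ₂ := h₁.trans h₁₂
  have hneg : -(Real.pi * μ₂ * c) < 0 := neg_lt_zero.2 (by positivity)
  have hzero : (μ₁ - μ₂) * c < 0 := mul_neg_of_neg_of_pos (sub_neg.2 h₁₂) hc
  have hpos : 0 < Real.pi * μ₁ * c := by positivity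
  have hle : -c ≤ c := by linarith
  refine ⟨hmono, hRot_neg_self μ₁ μ₂ hc, hneg, hRot_zero μ₁ μ₂ hc, hzero, hRot_self μ₁ μ₂ hc,
    hpos, ?_, ?_⟩
  · obtain ⟨D, hD, hD0⟩ := intermediate_value_Icc hle (continuous_hRot μ₁ μ₂ c).continuousOn
      (show (0 : ℝ) ∈ Set.Icc (hRot μ₁ μ₂ c (-c)) (hRot μ₁ μ₂ c c) by
        rw [hRot_neg_self μ₁ μ₂ hc, hRot_self μ₁ μ₂ hc]
        exact ⟨hneg.le, hpos.le⟩)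
    exact ⟨D, ⟨hD, hD0⟩, fun E hE => hmono.injOn hE.1 hD (hE.2.trans hD0.symm)⟩
  · intro D hD hD0
    constructor
    · rw [← hmono.lt_iff_lt ⟨by linarith, hc.le⟩ hD, hRot_zero μ₁ μ₂ hc, hD0]
      exact hzero
    · rw [← hmono.lt_iff_lt hD (Set.right_mem_Icc.2 hle), hRot_self μ₁ μ₂ hc, hD0]
      exact hpos
end

section
/- Let μ₁, μ₂ be real numbers, a > 0, and D a real number with |D| < a. Then (1/(2π)) · ∫₀^{2π} μ(D − a·cos ψ)·(D − a·cos ψ) dψ = (1/π)·[(μ₁ − μ₂)·√(a² − D²) + D·((μ₂ − μ₁)·arccos(D/a) + π·μ₁)], where μ(v) = μ₁ if v > 0 and μ(v) = μ₂ if v ≤ 0. -/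
open Real intervalIntegral

/-- The asymmetric piecewise-constant viscous damping coefficient:
forward coefficient `μ₁` for positive velocity, backward coefficient `μ₂` otherwise. -/
noncomputable def dampCoef (μ₁ μ₂ v : ℝ) : ℝ := if 0 < v then μ₁ else μ₂

lemma dampCoef_mul_of_nonneg (μ₁ μ₂ : ℝ) {v : ℝ} (hv : 0 ≤ v) :
    dampCoef μ₁ μ₂ v * v = μ₁ * v := by
  rcases hv.eq_or_lt with rfl | h
  · simp
  · simp [dampCoef, h]

lemma dampCoef_mul_of_nonpos (μ₁ μ₂ : ℝ) {v : ℝ} (hv : v ≤ 0) :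
    dampCoef μ₁ μ₂ v * v = μ₂ * v := by
  simp [dampCoef, hv.not_gt]

lemma continuous_dampCoef_mul (μ₁ μ₂ : ℝ) :
    Continuous fun v => dampCoef μ₁ μ₂ v * v := by
  have h : (fun v => dampCoef μ₁ μ₂ v * v) = fun v => μ₁ * max v 0 + μ₂ * min v 0 := by
    funext v
    rcases le_total 0 v with hv | hv
    · simp [dampCoef_mul_of_nonneg, hv]
    · simp [dampCoef_mul_of_nonpos, hv]
  rw [h]
  fun_prop

lemma integral_const_sub_mul_cos (a D x y : ℝ) :
    ∫ ψ in x..y, (D - a * Real.cos ψ) = D * (y - x) - a * (Real.sin y - Real.sin x) := by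
  rw [intervalIntegral.integral_sub (by simp)
    ((by fun_prop : Continuous fun ψ => a * Real.cos ψ).intervalIntegrable _ _)]
  simp [mul_comm]

theorem zeroth_fourier_coefficient_damping (μ₁ μ₂ a D : ℝ) (ha : 0 < a)
    (hD : |D| < a) :
    (1 / (2 * Real.pi)) *
        ∫ ψ in (0 : ℝ)..(2 * Real.pi),
          dampCoef μ₁ μ₂ (D - a * Real.cos ψ) * (D - a * Real.cos ψ)
      = (1 / Real.pi) *
          ((μ₁ - μ₂) * Real.sqrt (a^2 - D^2) +
            D * ((μ₂ - μ₁) * Real.arccos (D / a) + Real.pi * μ₁)) := by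
  obtain ⟨hD₁, hD₂⟩ := abs_lt.mp hD
  have h_sin : a * Real.sin (Real.arccos (D / a)) = Real.sqrt (a ^ 2 - D ^ 2) := by
    rw [Real.sin_arccos, show a ^ 2 - D ^ 2 = a ^ 2 * (1 - (D / a) ^ 2) by field_simp,
      Real.sqrt_mul (sq_nonneg a), Real.sqrt_sq ha.le]
  have h_cos : a * Real.cos (Real.arccos (D / a)) = D := by
    rw [Real.cos_arccos (by rw [le_div_iff₀ ha]; linarith) (by rw [div_le_iff₀ ha]; linarith)]
    field_simp
  have hθ₀ := Real.arccos_nonneg (D / a)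
  have hθ₁ := Real.arccos_le_pi (D / a)
  rw [← h_sin]
  generalize Real.arccos (D / a) = θ at *
  have h_le : ∀ ψ, 0 ≤ ψ → ψ ≤ θ → D - a * Real.cos ψ ≤ 0 := fun ψ h₀ h₁ => by
    have := mul_le_mul_of_nonneg_left (Real.cos_le_cos_of_nonneg_of_le_pi h₀ hθ₁ h₁) ha.le
    linarith
  have h_ge : ∀ ψ, θ ≤ ψ → ψ ≤ Real.pi → 0 ≤ D - a * Real.cos ψ := fun ψ h₀ h₁ => by
    have := mul_le_mul_of_nonneg_left (Real.cos_le_cos_of_nonneg_of_le_pi hθ₀ h₁ h₀) ha.le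
    linarith
  have h_int : ∀ x y, IntervalIntegrable (fun ψ =>
      dampCoef μ₁ μ₂ (D - a * Real.cos ψ) * (D - a * Real.cos ψ)) MeasureTheory.volume x y :=
    fun x y => ((continuous_dampCoef_mul μ₁ μ₂).comp
      (by fun_prop : Continuous fun ψ => D - a * Real.cos ψ)).intervalIntegrable x y
  have h_left : ∫ ψ in (0 : ℝ)..θ, dampCoef μ₁ μ₂ (D - a * Real.cos ψ) * (D - a * Real.cos ψ)
      = μ₂ * (D * θ - a * Real.sin θ) := by
    rw [intervalIntegral.integral_congr (g := fun ψ => μ₂ * (D - a * Real.cos ψ)),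
      intervalIntegral.integral_const_mul, integral_const_sub_mul_cos]
    · simp
    · intro ψ hψ
      rw [Set.uIcc_of_le hθ₀] at hψ
      exact dampCoef_mul_of_nonpos _ _ (h_le ψ hψ.1 hψ.2)
  have h_right : ∫ ψ in θ..Real.pi,
      dampCoef μ₁ μ₂ (D - a * Real.cos ψ) * (D - a * Real.cos ψ)
      = μ₁ * (D * (Real.pi - θ) + a * Real.sin θ) := by
    rw [intervalIntegral.integral_congr (g := fun ψ => μ₁ * (D - a * Real.cos ψ)),
      intervalIntegral.integral_const_mul, integral_const_sub_mul_cos]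
    · simp
    · intro ψ hψ
      rw [Set.uIcc_of_le hθ₁] at hψ
      exact dampCoef_mul_of_nonneg _ _ (h_ge ψ hψ.1 hψ.2)
  have h_symm : ∫ ψ in Real.pi..(2 * Real.pi),
      dampCoef μ₁ μ₂ (D - a * Real.cos ψ) * (D - a * Real.cos ψ)
      = ∫ ψ in (0 : ℝ)..Real.pi,
        dampCoef μ₁ μ₂ (D - a * Real.cos ψ) * (D - a * Real.cos ψ) := by
    have h := intervalIntegral.integral_comp_sub_left (a := 0) (b := Real.pi) (fun ψ =>
      dampCoef μ₁ μ₂ (D - a * Real.cos ψ) * (D - a * Real.cos ψ)) (2 * Real.pi)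
    simp only [Real.cos_two_pi_sub, sub_zero] at h
    rw [h, show 2 * Real.pi - Real.pi = Real.pi by ring]
  rw [← intervalIntegral.integral_add_adjacent_intervals (h_int 0 Real.pi) (h_int _ _), h_symm,
    ← intervalIntegral.integral_add_adjacent_intervals (h_int 0 θ) (h_int _ _), h_left, h_right]
  field_simp
  ring
end
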